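/- Suppose y₁, y₂ : ℝ → ℝ solve y'''(x) − x²y''(x) − xy'(x) + y(x) = 0 on ℝ, y₁(x) = Σ_{r=0}^∞ c_r x^{3r} with c₀ = 1 and y₂(x) = x²·Σ_{r=0}^∞ d_r x^{3r} with d₀ = 1, both series converging for all real x. Then the function u(x) = 2·3^{−1/3}·Γ(2/3)·y₁(x) + y₂(x) − 2·3^{−2/3}·Γ(2/3)²·x is a solution of the same equation satisfying x·u(x) → 1 as x → +∞, where Γ denotes the real Gamma function. -/

import Mathlib

open Filter

open Real Set MeasureTheory Topology

lemma lintegral_pow_mul_exp_neg_mul_cube (k : ℕ) {b : ℝ} (hb : 0 < b) :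
    ∫⁻ x in Ioi (0 : ℝ), ENNReal.ofReal (x ^ k * exp (-b * x ^ 3)) =
      ENNReal.ofReal (b ^ (-((k : ℝ) + 1) / 3) * (1 / 3) * Gamma (((k : ℝ) + 1) / 3)) := by
  have hk : (-1 : ℝ) < k := by linarith [k.cast_nonneg (α := ℝ)]
  have heq : EqOn (fun x : ℝ => x ^ (k : ℝ) * exp (-b * x ^ (3 : ℝ)))
      (fun x => x ^ k * exp (-b * x ^ 3)) (Ioi 0) := fun x _ => by
    norm_cast
  rw [← integral_rpow_mul_exp_neg_mul_rpow three_pos hk hb,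
    setIntegral_congr_fun measurableSet_Ioi heq, ofReal_integral_eq_lintegral_ofReal]
  · exact (integrableOn_rpow_mul_exp_neg_mul_rpow hk three_pos hb).congr_fun heq
      measurableSet_Ioi
  · filter_upwards [ae_restrict_mem measurableSet_Ioi] with x hx
    have : (0 : ℝ) < x := hx
    positivity

lemma one_third_rpow_mul_one_third (p : ℝ) : (1 / 3 : ℝ) ^ p * (1 / 3) = 3 ^ (-p - 1) := by
  rw [rpow_sub_one (by norm_num), rpow_neg (by norm_num), one_div, inv_rpow (by norm_num),
    div_eq_mul_inv]

lemma one_third_rpow_neg_two_thirds_mul :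
    (1 / 3 : ℝ) ^ (-(2 / 3) : ℝ) * (1 / 3) = 3 ^ (-(1 / 3) : ℝ) := by
  rw [one_third_rpow_mul_one_third]; norm_num

lemma lintegral_mul_exp_neg_cube :
    ∫⁻ x in Ioi (0 : ℝ), ENNReal.ofReal (x * exp (-(x ^ 3 / 3))) =
      ENNReal.ofReal (3 ^ (-(1 / 3) : ℝ) * Gamma (2 / 3)) := by
  have h := lintegral_pow_mul_exp_neg_mul_cube 1 (b := 1 / 3) (by norm_num)
  rw [← one_third_rpow_neg_two_thirds_mul]
  convert h using 5
  · ring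
  · ring_nf
  · norm_num
  · norm_num

lemma cube_div_three_rpow {s : ℝ} (hs : 0 < s) (p : ℝ) :
    (s ^ 3 / 3) ^ p = s ^ (3 * p) * (1 / 3) ^ p := by
  rw [div_eq_mul_one_div, mul_rpow (by positivity) (by norm_num), rpow_mul hs.le]
  norm_cast

/-- Both sides are the double integral of `s³ z exp (-s³ (1 + z³) / 3)` over the quadrant. -/
lemma Gamma_one_third_mul_lintegral :
    ENNReal.ofReal (3 ^ (-(2 / 3) : ℝ) * Gamma (1 / 3)) *
        ∫⁻ z in Ioi (0 : ℝ), ENNReal.ofReal (z * (1 + z ^ 3) ^ (-(4 / 3) : ℝ)) =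
      ENNReal.ofReal ((3 ^ (-(1 / 3) : ℝ) * Gamma (2 / 3)) ^ 2) := by
  have hG : Gamma (4 / 3) = 1 / 3 * Gamma (1 / 3) := by
    rw [← Gamma_add_one (by norm_num)]; norm_num
  have hG1 : 0 < Gamma (1 / 3 : ℝ) := Gamma_pos_of_pos (by norm_num)
  have hG2 : 0 < Gamma (2 / 3 : ℝ) := Gamma_pos_of_pos (by norm_num)
  calc
    _ = ∫⁻ z in Ioi (0 : ℝ), ENNReal.ofReal
          (3 ^ (-(2 / 3) : ℝ) * Gamma (1 / 3) * (z * (1 + z ^ 3) ^ (-(4 / 3) : ℝ))) := by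
      rw [← lintegral_const_mul _ (by fun_prop)]
      exact lintegral_congr fun z => (ENNReal.ofReal_mul (by positivity)).symm
    _ = ∫⁻ z in Ioi (0 : ℝ), ∫⁻ s in Ioi (0 : ℝ), ENNReal.ofReal
          (z * (s ^ 3 * exp (-((1 + z ^ 3) / 3) * s ^ 3))) := by
      refine setLIntegral_congr_fun measurableSet_Ioi fun z hz => ?_
      have hz : 0 < z := hz
      have h := lintegral_pow_mul_exp_neg_mul_cube 3 (b := (1 + z ^ 3) / 3) (by positivity)
      simp only [ENNReal.ofReal_mul hz.le]
      rw [lintegral_const_mul _ (by fun_prop), h, ← ENNReal.ofReal_mul hz.le]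
      congr 1
      have e : (((3 : ℕ) : ℝ) + 1) / 3 = 4 / 3 := by norm_num
      rw [neg_div, e, hG, div_eq_mul_one_div (1 + z ^ 3), mul_rpow (by positivity) (by norm_num)]
      have : (1 / 3 : ℝ) ^ (-(4 / 3) : ℝ) * (1 / 3) * (1 / 3) = 3 ^ (-(2 / 3) : ℝ) := by
        rw [one_third_rpow_mul_one_third, mul_one_div, ← rpow_sub_one (by norm_num)]
        norm_num
      rw [← this]; ring
    _ = ∫⁻ s in Ioi (0 : ℝ), ∫⁻ z in Ioi (0 : ℝ), ENNReal.ofReal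
          (z * (s ^ 3 * exp (-((1 + z ^ 3) / 3) * s ^ 3))) :=
      lintegral_lintegral_swap (by fun_prop)
    _ = ∫⁻ s in Ioi (0 : ℝ), ENNReal.ofReal (3 ^ (-(1 / 3) : ℝ) * Gamma (2 / 3)) *
          ENNReal.ofReal (s * exp (-(s ^ 3 / 3))) := by
      refine setLIntegral_congr_fun measurableSet_Ioi fun s hs => ?_
      have hs : 0 < s := hs
      have h := lintegral_pow_mul_exp_neg_mul_cube 1 (b := s ^ 3 / 3) (by positivity)
      have hsplit : ∀ z : ℝ, z * (s ^ 3 * exp (-((1 + z ^ 3) / 3) * s ^ 3)) =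
          s ^ 3 * exp (-(s ^ 3 / 3)) * (z ^ 1 * exp (-(s ^ 3 / 3) * z ^ 3)) := fun z => by
        rw [show -((1 + z ^ 3) / 3) * s ^ 3 = -(s ^ 3 / 3) + -(s ^ 3 / 3) * z ^ 3 by ring, exp_add]
        ring
      simp only [hsplit]
      simp only [ENNReal.ofReal_mul (show 0 ≤ s ^ 3 * exp (-(s ^ 3 / 3)) by positivity)]
      rw [lintegral_const_mul _ (by fun_prop), h, ← ENNReal.ofReal_mul (by positivity),
        ← ENNReal.ofReal_mul (by positivity), ← one_third_rpow_neg_two_thirds_mul]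
      congr 1
      have e : (((1 : ℕ) : ℝ) + 1) / 3 = 2 / 3 := by norm_num
      rw [neg_div, e, cube_div_three_rpow hs, show (3 : ℝ) * -(2 / 3) = -2 by norm_num,
        rpow_neg hs.le, rpow_two]
      field_simp
    _ = _ := by
      rw [lintegral_const_mul _ (by fun_prop), lintegral_mul_exp_neg_cube,
        ← ENNReal.ofReal_mul (by positivity), sq]

lemma hasDerivAt_exp_neg_cube (x : ℝ) :
    HasDerivAt (fun x : ℝ => exp (-(x ^ 3 / 3))) (-(x ^ 2 * exp (-(x ^ 3 / 3)))) x := by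
  refine (((hasDerivAt_pow 3 x).div_const 3).fun_neg).exp.congr_deriv ?_
  push_cast
  ring

lemma tendsto_exp_neg_cube : Tendsto (fun x : ℝ => exp (-(x ^ 3 / 3))) atTop (𝓝 0) :=
  tendsto_exp_neg_atTop_nhds_zero.comp
    ((tendsto_pow_atTop three_ne_zero).atTop_div_const three_pos)

lemma tendsto_zero_of_hasDerivAt_exp_neg_cube {G : ℝ → ℝ}
    (hG : ∀ x, HasDerivAt G (-(2 * x * exp (-(x ^ 3 / 3)))) x)
    (hG0 : G 0 = 2 * (3 ^ (-(1 / 3) : ℝ) * Gamma (2 / 3))) : Tendsto G atTop (𝓝 0) := by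
  have hG2 : 0 < Gamma (2 / 3 : ℝ) := Gamma_pos_of_pos (by norm_num)
  have hnn : 0 ≤ᵐ[volume.restrict (Ioi (0 : ℝ))] fun x : ℝ => x * exp (-(x ^ 3 / 3)) := by
    filter_upwards [ae_restrict_mem measurableSet_Ioi] with x hx
    have : (0 : ℝ) < x := hx
    positivity
  have hint : IntegrableOn (fun x : ℝ => x * exp (-(x ^ 3 / 3))) (Ioi 0) := by
    refine ⟨by fun_prop, ?_⟩
    rw [hasFiniteIntegral_iff_ofReal hnn, lintegral_mul_exp_neg_cube]
    exact ENNReal.ofReal_lt_top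
  have hval : ∫ x in Ioi (0 : ℝ), x * exp (-(x ^ 3 / 3)) =
      3 ^ (-(1 / 3) : ℝ) * Gamma (2 / 3) := by
    rw [integral_eq_lintegral_of_nonneg_ae hnn (by fun_prop), lintegral_mul_exp_neg_cube,
      ENNReal.toReal_ofReal (by positivity)]
  have hlim := (intervalIntegral_tendsto_integral_Ioi 0 hint tendsto_id).const_mul (-2)
  have hftc : ∀ x, G x = G 0 + -2 * ∫ t in (0 : ℝ)..x, t * exp (-(t ^ 3 / 3)) := fun x => by
    rw [← intervalIntegral.integral_const_mul,
      intervalIntegral.integral_eq_sub_of_hasDerivAt (f := G)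
      (fun t _ => (hG t).congr_deriv (by ring))
      (Continuous.intervalIntegrable (by fun_prop) _ _)]
    ring
  have := (hlim.const_add (G 0)).congr fun x => (hftc x).symm
  rwa [hval, hG0, show 2 * ((3 : ℝ) ^ (-(1 / 3) : ℝ) * Gamma (2 / 3)) +
    -2 * (3 ^ (-(1 / 3) : ℝ) * Gamma (2 / 3)) = 0 by ring] at this

lemma tendsto_mul_exp_cube_mul {G : ℝ → ℝ}
    (hG : ∀ x, HasDerivAt G (-(2 * x * exp (-(x ^ 3 / 3)))) x)
    (hlim : Tendsto G atTop (𝓝 0)) :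
    Tendsto (fun x => x * (exp (x ^ 3 / 3) * G x)) atTop (𝓝 2) := by
  have hinv : Tendsto (fun x : ℝ => x⁻¹) atTop (𝓝 0) := tendsto_inv_atTop_zero
  have key : Tendsto (fun x => G x / (x⁻¹ * exp (-(x ^ 3 / 3)))) atTop (𝓝 2) := by
    refine HasDerivAt.lhopital_zero_atTop (.of_forall hG)
      (g' := fun x => -((x + (x ^ 2)⁻¹) * exp (-(x ^ 3 / 3)))) ?_ ?_ hlim ?_ ?_
    · filter_upwards [eventually_gt_atTop 0] with x hx
      refine ((hasDerivAt_inv hx.ne').mul (hasDerivAt_exp_neg_cube x)).congr_deriv ?_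
      field_simp
      ring
    · filter_upwards [eventually_gt_atTop 0] with x hx
      have : 0 < (x + (x ^ 2)⁻¹) * exp (-(x ^ 3 / 3)) := by positivity
      linarith
    · simpa using hinv.mul tendsto_exp_neg_cube
    · have h : Tendsto (fun x : ℝ => 2 / (1 + x⁻¹ ^ 3)) atTop (𝓝 (2 / (1 + 0 ^ 3))) :=
        tendsto_const_nhds.div ((hinv.pow 3).const_add 1) (by norm_num)
      norm_num at h
      refine Tendsto.congr' ?_ h
      filter_upwards [eventually_gt_atTop 0] with x hx
      field_simp
  refine key.congr' ?_
  filter_upwards [eventually_gt_atTop 0] with x hx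
  rw [exp_neg]
  field_simp

lemma tail_kernel {G : ℝ → ℝ}
    (hG : ∀ x, HasDerivAt G (-(2 * x * exp (-(x ^ 3 / 3)))) x)
    (hlim : Tendsto G atTop (𝓝 0)) {x : ℝ} (hx : 0 < x) :
    0 ≤ 2 - x * (exp (x ^ 3 / 3) * G x) ∧
    ∫⁻ z in Ioi (0 : ℝ), ENNReal.ofReal
        (2 * z ^ 2 * (1 + z ^ 3) ^ (-(4 / 3) : ℝ) * exp (-((x * z) ^ 3 / 3))) =
      ENNReal.ofReal (2 - x * (exp (x ^ 3 / 3) * G x)) := by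
  set K : ℝ → ℝ := fun z =>
    2 * z ^ 2 * (1 + z ^ 3) ^ (-(4 / 3) : ℝ) * exp (-((x * z) ^ 3 / 3)) with hK
  set P : ℝ → ℝ := fun z => -2 * exp (-((x * z) ^ 3 / 3)) * (1 + z ^ 3) ^ (-(1 / 3) : ℝ) +
    x * (exp (x ^ 3 / 3) * G (x * (1 + z ^ 3) ^ (1 / 3 : ℝ))) with hP
  have hderiv : ∀ z ∈ Ici (0 : ℝ), HasDerivAt P (K z) z := fun z hz => by
    have hz : 0 ≤ z := hz
    have hpos : 0 < 1 + z ^ 3 := by positivity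
    have hbase : HasDerivAt (fun z : ℝ => 1 + z ^ 3) (3 * z ^ 2) z := by
      simpa using (hasDerivAt_pow 3 z).const_add 1
    have h1 : HasDerivAt (fun z : ℝ => exp (-((x * z) ^ 3 / 3)))
        (-((x * z) ^ 2 * exp (-((x * z) ^ 3 / 3))) * x) z := by
      simpa [Function.comp_def] using
        (hasDerivAt_exp_neg_cube (x * z)).comp z ((hasDerivAt_id z).const_mul x)
    have h2 := hbase.rpow_const (p := -(1 / 3)) (.inl hpos.ne')
    have h3 := (hbase.rpow_const (p := 1 / 3) (.inl hpos.ne')).const_mul x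
    have h4 := (((hG (x * (1 + z ^ 3) ^ (1 / 3 : ℝ))).comp z h3).const_mul
      (exp (x ^ 3 / 3))).const_mul x
    refine (((h1.const_mul (-2)).mul h2).add h4).congr_deriv ?_
    have hcube : ((1 + z ^ 3) ^ (1 / 3 : ℝ)) ^ 3 = 1 + z ^ 3 := by
      rw [← rpow_natCast, ← rpow_mul hpos.le]; norm_num
    have hexp : exp (-((x * (1 + z ^ 3) ^ (1 / 3 : ℝ)) ^ 3 / 3)) =
        exp (-((x * z) ^ 3 / 3)) / exp (x ^ 3 / 3) := by
      rw [mul_pow, hcube, ← exp_sub]; ring_nf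
    have hprod : (1 + z ^ 3) ^ (1 / 3 : ℝ) * (1 + z ^ 3) ^ (1 / 3 - 1 : ℝ) =
        (1 + z ^ 3) ^ (-(1 / 3) : ℝ) := by
      rw [← rpow_add hpos]; norm_num
    rw [hexp, show (-(1 / 3) - 1 : ℝ) = -(4 / 3) by norm_num, hK]
    generalize (1 + z ^ 3) ^ (1 / 3 : ℝ) = A at *
    rw [← hprod]
    have := exp_ne_zero (x ^ 3 / 3)
    field_simp
    ring
  have hnn : ∀ z ∈ Ioi (0 : ℝ), 0 ≤ K z := fun z hz => by
    have hz : 0 < z := hz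
    positivity
  have hbase : Tendsto (fun z : ℝ => 1 + z ^ 3) atTop atTop :=
    tendsto_atTop_add_const_left _ _ (tendsto_pow_atTop three_ne_zero)
  have hPlim : Tendsto P atTop (𝓝 0) := by
    have h1 : Tendsto (fun z : ℝ => exp (-((x * z) ^ 3 / 3))) atTop (𝓝 0) :=
      tendsto_exp_neg_cube.comp (tendsto_id.const_mul_atTop hx)
    have h2 : Tendsto (fun z : ℝ => (1 + z ^ 3) ^ (-(1 / 3) : ℝ)) atTop (𝓝 0) :=
      (tendsto_rpow_neg_atTop (by norm_num)).comp hbase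
    have h3 : Tendsto (fun z : ℝ => G (x * (1 + z ^ 3) ^ (1 / 3 : ℝ))) atTop (𝓝 0) :=
      hlim.comp (((tendsto_rpow_atTop (by norm_num)).comp hbase).const_mul_atTop hx)
    simpa [hP] using ((h1.const_mul (-2)).mul h2).add
      ((h3.const_mul (exp (x ^ 3 / 3))).const_mul x)
  have hint := integrableOn_Ioi_deriv_of_nonneg' hderiv hnn hPlim
  have hval := integral_Ioi_of_hasDerivAt_of_nonneg' hderiv hnn hPlim
  have hP0 : 0 - P 0 = 2 - x * (exp (x ^ 3 / 3) * G x) := by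
    simp only [hP]; norm_num; ring
  rw [hP0] at hval
  refine ⟨hval ▸ setIntegral_nonneg measurableSet_Ioi hnn, ?_⟩
  rw [← hval, ofReal_integral_eq_lintegral_ofReal hint]
  exact (ae_restrict_mem measurableSet_Ioi).mono hnn

lemma lintegral_tail {G : ℝ → ℝ}
    (hG : ∀ x, HasDerivAt G (-(2 * x * exp (-(x ^ 3 / 3)))) x)
    (hlim : Tendsto G atTop (𝓝 0)) :
    ∫⁻ x in Ioi (0 : ℝ), ENNReal.ofReal (2 - x * (exp (x ^ 3 / 3) * G x)) =
      ENNReal.ofReal (2 * (3 ^ (-(1 / 3) : ℝ) * Gamma (2 / 3)) ^ 2) := by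
  have hG1 : 0 < Gamma (1 / 3 : ℝ) := Gamma_pos_of_pos (by norm_num)
  calc
    _ = ∫⁻ x in Ioi (0 : ℝ), ∫⁻ z in Ioi (0 : ℝ), ENNReal.ofReal
          (2 * z ^ 2 * (1 + z ^ 3) ^ (-(4 / 3) : ℝ) * exp (-((x * z) ^ 3 / 3))) :=
      setLIntegral_congr_fun measurableSet_Ioi fun x hx => (tail_kernel hG hlim hx).2.symm
    _ = ∫⁻ z in Ioi (0 : ℝ), ∫⁻ x in Ioi (0 : ℝ), ENNReal.ofReal
          (2 * z ^ 2 * (1 + z ^ 3) ^ (-(4 / 3) : ℝ) * exp (-((x * z) ^ 3 / 3))) :=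
      lintegral_lintegral_swap (by fun_prop)
    _ = ∫⁻ z in Ioi (0 : ℝ), ENNReal.ofReal (2 * (3 ^ (-(2 / 3) : ℝ) * Gamma (1 / 3))) *
          ENNReal.ofReal (z * (1 + z ^ 3) ^ (-(4 / 3) : ℝ)) := by
      refine setLIntegral_congr_fun measurableSet_Ioi fun z hz => ?_
      have hz : 0 < z := hz
      have h := lintegral_pow_mul_exp_neg_mul_cube 0 (b := z ^ 3 / 3) (by positivity)
      have hsplit : ∀ x : ℝ, exp (-((x * z) ^ 3 / 3)) = x ^ 0 * exp (-(z ^ 3 / 3) * x ^ 3) :=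
        fun x => by rw [pow_zero, one_mul]; ring_nf
      simp only [hsplit, ENNReal.ofReal_mul
        (show 0 ≤ 2 * z ^ 2 * (1 + z ^ 3) ^ (-(4 / 3) : ℝ) by positivity)]
      rw [lintegral_const_mul _ (by fun_prop), h, ← ENNReal.ofReal_mul (by positivity),
        ← ENNReal.ofReal_mul (by positivity)]
      congr 1
      have e : (((0 : ℕ) : ℝ) + 1) / 3 = 1 / 3 := by norm_num
      have e' : (1 / 3 : ℝ) ^ (-(1 / 3) : ℝ) * (1 / 3) = 3 ^ (-(2 / 3) : ℝ) := by
        rw [one_third_rpow_mul_one_third]; norm_num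
      rw [neg_div, e, cube_div_three_rpow hz, show (3 : ℝ) * -(1 / 3) = -1 by norm_num,
        rpow_neg_one, ← e']
      field_simp
    _ = _ := by
      rw [lintegral_const_mul _ (by fun_prop), ENNReal.ofReal_mul two_pos.le, mul_assoc,
        Gamma_one_third_mul_lintegral, ← ENNReal.ofReal_mul two_pos.le]

/-- Integrating the equation once gives `u'' - x² u' + x u = 2`; then `x u' - u` satisfies a
first-order linear equation, and `u' → 0` at infinity because `∫₀^∞ u'' = -u' 0`. -/
lemma tendsto_mul_of_ode {u u₁ u₂ u₃ : ℝ → ℝ} (hu : ∀ x, HasDerivAt u (u₁ x) x)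
    (hu₁ : ∀ x, HasDerivAt u₁ (u₂ x) x) (hu₂ : ∀ x, HasDerivAt u₂ (u₃ x) x)
    (hode : ∀ x, u₃ x - x ^ 2 * u₂ x - x * u₁ x + u x = 0)
    (h0 : u 0 = 2 * (3 ^ (-(1 / 3) : ℝ) * Gamma (2 / 3)))
    (h1 : u₁ 0 = -(2 * (3 ^ (-(1 / 3) : ℝ) * Gamma (2 / 3)) ^ 2)) (h2 : u₂ 0 = 2) :
    Tendsto (fun x => x * u x) atTop (𝓝 1) := by
  have hint : ∀ x, u₂ x - x ^ 2 * u₁ x + x * u x = 2 := fun x => by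
    have hd : ∀ x, HasDerivAt (fun x => u₂ x - x ^ 2 * u₁ x + x * u x) 0 x := fun x => by
      refine (((hu₂ x).sub ((hasDerivAt_pow 2 x).mul (hu₁ x))).add
        ((hasDerivAt_id x).mul (hu x))).congr_deriv ?_
      simp only [id]
      push_cast
      linear_combination hode x
    have := is_const_of_deriv_eq_zero (fun x => (hd x).differentiableAt)
      (fun x => (hd x).deriv) x 0
    simpa [h2] using this
  set G : ℝ → ℝ := fun x => (u x - x * u₁ x) * exp (-(x ^ 3 / 3)) with hGdef
  have hG : ∀ x, HasDerivAt G (-(2 * x * exp (-(x ^ 3 / 3)))) x := fun x => by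
    refine (((hu x).sub ((hasDerivAt_id x).mul (hu₁ x))).mul
      (hasDerivAt_exp_neg_cube x)).congr_deriv ?_
    simp only [id, Pi.sub_apply, Pi.mul_apply]
    linear_combination (-x * exp (-(x ^ 3 / 3))) * hint x
  have hlim := tendsto_zero_of_hasDerivAt_exp_neg_cube hG (by simp [hGdef, h0])
  have hW : ∀ x, exp (x ^ 3 / 3) * G x = u x - x * u₁ x := fun x => by
    rw [hGdef, mul_left_comm, ← exp_add, add_neg_cancel, exp_zero, mul_one]
  have hW2 : Tendsto (fun x => x * (u x - x * u₁ x)) atTop (𝓝 2) := by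
    simpa only [hW] using tendsto_mul_exp_cube_mul hG hlim
  have hH : ∀ x, 2 - x * (exp (x ^ 3 / 3) * G x) = u₂ x := fun x => by
    rw [hW]; linear_combination -hint x
  have hnn : 0 ≤ᵐ[volume.restrict (Ioi (0 : ℝ))] u₂ := by
    filter_upwards [ae_restrict_mem measurableSet_Ioi] with x hx
    exact hH x ▸ (tail_kernel hG hlim hx).1
  have hcont : Continuous u₂ := continuous_iff_continuousAt.2 fun x => (hu₂ x).continuousAt
  have hlint : ∫⁻ x in Ioi (0 : ℝ), ENNReal.ofReal (u₂ x) =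
      ENNReal.ofReal (2 * (3 ^ (-(1 / 3) : ℝ) * Gamma (2 / 3)) ^ 2) := by
    simpa only [hH] using lintegral_tail hG hlim
  have hu₂int : IntegrableOn u₂ (Ioi 0) := by
    refine ⟨hcont.aestronglyMeasurable, ?_⟩
    rw [hasFiniteIntegral_iff_ofReal hnn, hlint]
    exact ENNReal.ofReal_lt_top
  have hu₂val : ∫ x in Ioi (0 : ℝ), u₂ x = -u₁ 0 := by
    rw [integral_eq_lintegral_of_nonneg_ae hnn hcont.aestronglyMeasurable, hlint,
      ENNReal.toReal_ofReal (by positivity), h1, neg_neg]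
  have hu₁lim : Tendsto u₁ atTop (𝓝 0) := by
    have := (intervalIntegral_tendsto_integral_Ioi 0 hu₂int tendsto_id).const_add (u₁ 0)
    rw [hu₂val, add_neg_cancel] at this
    refine this.congr fun x => ?_
    rw [intervalIntegral.integral_eq_sub_of_hasDerivAt (fun t _ => hu₁ t)
      (hcont.intervalIntegrable _ _), id, add_sub_cancel]
  have hinv : Tendsto (fun x : ℝ => x⁻¹) atTop (𝓝 0) := tendsto_inv_atTop_zero
  have hv : Tendsto (fun x => u x * x⁻¹) atTop (𝓝 0) := by
    have := hu₁lim.add (hW2.mul (hinv.pow 2))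
    norm_num at this
    refine this.congr' ?_
    filter_upwards [eventually_gt_atTop 0] with x hx
    field_simp
    ring
  have key : Tendsto (fun x => u x * x⁻¹ / (x⁻¹) ^ 2) atTop (𝓝 1) := by
    refine HasDerivAt.lhopital_zero_atTop (f' := fun x => u₁ x * x⁻¹ + u x * (-(x ^ 2)⁻¹))
      (g' := fun x => 2 * x⁻¹ * (-(x ^ 2)⁻¹)) ?_ ?_ ?_ hv (by simpa using hinv.pow 2) ?_
    · filter_upwards [eventually_gt_atTop 0] with x hx
      exact (hu x).mul (hasDerivAt_inv hx.ne')
    · filter_upwards [eventually_gt_atTop 0] with x hx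
      simpa only [Nat.cast_ofNat, Nat.add_one_sub_one, pow_one] using
        (hasDerivAt_inv hx.ne').fun_pow 2
    · filter_upwards [eventually_gt_atTop 0] with x hx
      have : 0 < 2 * x⁻¹ * (x ^ 2)⁻¹ := by positivity
      linarith
    · have := hW2.div_const 2
      norm_num at this
      refine this.congr' ?_
      filter_upwards [eventually_gt_atTop 0] with x hx
      field_simp
      ring
  refine key.congr' ?_
  filter_upwards [eventually_gt_atTop 0] with x hx
  field_simp

lemma eq_zero_of_abs_le_cube {f f₁ : ℝ → ℝ} {f₂ C : ℝ} (hf : ∀ x, HasDerivAt f (f₁ x) x)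
    (hf₁ : HasDerivAt f₁ f₂ 0) (hC : ∀ x, |x| ≤ 1 → |f x| ≤ C * |x| ^ 3) :
    f 0 = 0 ∧ f₁ 0 = 0 ∧ f₂ = 0 := by
  have hnear : ∀ᶠ x : ℝ in 𝓝[≠] 0, |x| ≤ 1 := by
    refine eventually_nhdsWithin_of_eventually_nhds ?_
    filter_upwards [Metric.closedBall_mem_nhds (0 : ℝ) one_pos] with x hx
    simpa using hx
  have hdiv : ∀ k, k < 3 → Tendsto (fun x => f x / x ^ k) (𝓝[≠] 0) (𝓝 0) := fun k hk => by
    have hb : Tendsto (fun x : ℝ => C * |x| ^ (3 - k)) (𝓝[≠] 0) (𝓝 0) := by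
      have : ContinuousAt (fun x : ℝ => C * |x| ^ (3 - k)) 0 := by fun_prop
      have h := this.tendsto.mono_left (nhdsWithin_le_nhds (s := {0}ᶜ))
      simpa [zero_pow (Nat.sub_ne_zero_of_lt hk)] using h
    refine squeeze_zero_norm' ?_ hb
    filter_upwards [hnear, self_mem_nhdsWithin] with x hx hx0
    have : 0 < |x| := abs_pos.2 hx0
    rw [norm_div, norm_pow, norm_eq_abs, norm_eq_abs, div_le_iff₀ (by positivity), mul_assoc,
      ← pow_add, Nat.sub_add_cancel hk.le]
    exact hC x hx
  have h0 : f 0 = 0 := by simpa using hC 0 (by simp)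
  have h1 : f₁ 0 = 0 := by
    refine tendsto_nhds_unique ?_ (hdiv 1 (by norm_num))
    refine (hf 0).tendsto_slope_zero.congr fun x => ?_
    simp [h0, div_eq_inv_mul]
  refine ⟨h0, h1, ?_⟩
  have h2 : Tendsto (fun x => f x / x ^ 2) (𝓝[≠] 0) (𝓝 (f₂ / 2)) := by
    refine HasDerivAt.lhopital_zero_nhdsNE (.of_forall hf)
      (.of_forall fun x => hasDerivAt_pow 2 x) ?_ (by simpa using hdiv 0 (by norm_num)) ?_ ?_
    · filter_upwards [self_mem_nhdsWithin] with x hx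
      simpa using hx
    · have : ContinuousAt (fun x : ℝ => x ^ 2) 0 := by fun_prop
      simpa using this.tendsto.mono_left (nhdsWithin_le_nhds (s := {0}ᶜ))
    · refine (hf₁.tendsto_slope_zero.div_const 2).congr fun x => ?_
      simp [h1, div_eq_inv_mul]
      ring
  linarith [tendsto_nhds_unique h2 (hdiv 2 (by norm_num))]

lemma exists_abs_tsum_sub_le {a : ℕ → ℝ}
    (ha : ∀ x : ℝ, Summable fun r : ℕ => a r * x ^ (3 * r)) :
    ∃ C, 0 ≤ C ∧ ∀ x : ℝ, |x| ≤ 1 → |∑' r : ℕ, a r * x ^ (3 * r) - a 0| ≤ C * |x| ^ 3 := by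
  have hs : Summable fun r => |a (r + 1)| := by
    simpa using ((summable_nat_add_iff 1).2 (ha 1)).abs
  refine ⟨∑' r, |a (r + 1)|, tsum_nonneg fun _ => abs_nonneg _, fun x hx => ?_⟩
  rw [(ha x).tsum_eq_zero_add]
  simp only [mul_zero, pow_zero, mul_one, add_sub_cancel_left]
  rw [← tsum_mul_right]
  refine (norm_eq_abs _).symm.trans_le
    (tsum_of_norm_bounded (hs.mul_right (|x| ^ 3)).hasSum fun r => ?_)
  rw [norm_mul, norm_pow, norm_eq_abs, norm_eq_abs, mul_add, pow_add]
  have : |x| ^ (3 * r) ≤ 1 := pow_le_one₀ (abs_nonneg x) hx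
  gcongr
  exact mul_le_of_le_one_left (by positivity) this

lemma ContDiff.hasDerivAt_iteratedDeriv {f : ℝ → ℝ} {n : WithTop ℕ∞} {m : ℕ}
    (hf : ContDiff ℝ n f) (hm : (m : WithTop ℕ∞) < n) (x : ℝ) :
    HasDerivAt (iteratedDeriv m f) (iteratedDeriv (m + 1) f x) x := by
  rw [iteratedDeriv_succ]
  exact (hf.differentiable_iteratedDeriv m hm x).hasDerivAt

/-- Connection formula: if `y₁ = Σ c_r x^{3r}` (with `c₀ = 1`) and
`y₂ = x² Σ d_r x^{3r}` (with `d₀ = 1`) are entire solutions of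
`y''' − x²y'' − xy' + y = 0`, then
`u = 2·3^{−1/3}Γ(2/3)·y₁ + y₂ − 2·3^{−2/3}Γ(2/3)²·x` is a solution with
`x·u(x) → 1` as `x → +∞`. -/
theorem connection_formula
    (c d : ℕ → ℝ) (hc0 : c 0 = 1) (hd0 : d 0 = 1)
    (hcsum : ∀ x : ℝ, Summable fun r : ℕ => c r * x ^ (3 * r))
    (hdsum : ∀ x : ℝ, Summable fun r : ℕ => d r * x ^ (3 * r))
    (y₁ y₂ : ℝ → ℝ)
    (hy₁ : ∀ x : ℝ, y₁ x = ∑' r : ℕ, c r * x ^ (3 * r))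
    (hy₂ : ∀ x : ℝ, y₂ x = x ^ 2 * ∑' r : ℕ, d r * x ^ (3 * r))
    (hy₁smooth : ContDiff ℝ 3 y₁) (hy₂smooth : ContDiff ℝ 3 y₂)
    (hy₁ode : ∀ x : ℝ,
      iteratedDeriv 3 y₁ x - x ^ 2 * iteratedDeriv 2 y₁ x - x * deriv y₁ x + y₁ x = 0)
    (hy₂ode : ∀ x : ℝ,
      iteratedDeriv 3 y₂ x - x ^ 2 * iteratedDeriv 2 y₂ x - x * deriv y₂ x + y₂ x = 0)
    (u : ℝ → ℝ)
    (hu : ∀ x : ℝ, u x =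
      2 * (3 : ℝ) ^ (-(1 / 3) : ℝ) * Real.Gamma (2 / 3) * y₁ x + y₂ x
        - 2 * (3 : ℝ) ^ (-(2 / 3) : ℝ) * Real.Gamma (2 / 3) ^ 2 * x) :
    (∀ x : ℝ,
      iteratedDeriv 3 u x - x ^ 2 * iteratedDeriv 2 u x - x * deriv u x + u x = 0) ∧
    Tendsto (fun x : ℝ => x * u x) atTop (nhds 1) := by
  set a : ℝ := 3 ^ (-(1 / 3) : ℝ) * Gamma (2 / 3) with ha
  have hA : 2 * (3 : ℝ) ^ (-(1 / 3) : ℝ) * Gamma (2 / 3) = 2 * a := mul_assoc _ _ _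
  have hB : 2 * (3 : ℝ) ^ (-(2 / 3) : ℝ) * Gamma (2 / 3) ^ 2 = 2 * a ^ 2 := by
    rw [ha, mul_pow, ← rpow_natCast ((3 : ℝ) ^ _), ← rpow_mul (by norm_num), mul_assoc]
    norm_num
  simp only [hA, hB] at hu
  have hy : ∀ y : ℝ → ℝ, ContDiff ℝ 3 y → (∀ x, HasDerivAt y (deriv y x) x) ∧
      (∀ x, HasDerivAt (deriv y) (iteratedDeriv 2 y x) x) ∧
      ∀ x, HasDerivAt (iteratedDeriv 2 y) (iteratedDeriv 3 y x) x := fun y h => by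
    refine ⟨fun x => ?_, fun x => ?_, fun x => ?_⟩
    · simpa using h.hasDerivAt_iteratedDeriv (m := 0) (by norm_num) x
    · simpa using h.hasDerivAt_iteratedDeriv (m := 1) (by norm_num) x
    · exact h.hasDerivAt_iteratedDeriv (m := 2) (by norm_num) x
  obtain ⟨h10, h11, h12⟩ := hy y₁ hy₁smooth
  obtain ⟨h20, h21, h22⟩ := hy y₂ hy₂smooth
  have hu0 : ∀ x, HasDerivAt u (2 * a * deriv y₁ x + deriv y₂ x - 2 * a ^ 2) x := fun x => by
    rw [funext hu]
    simpa using (((h10 x).const_mul (2 * a)).fun_add (h20 x)).fun_sub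
      ((hasDerivAt_id x).const_mul (2 * a ^ 2))
  have hu1 : ∀ x, HasDerivAt (fun x => 2 * a * deriv y₁ x + deriv y₂ x - 2 * a ^ 2)
      (2 * a * iteratedDeriv 2 y₁ x + iteratedDeriv 2 y₂ x) x := fun x =>
    (((h11 x).const_mul (2 * a)).add (h21 x)).sub_const _
  have hu2 : ∀ x, HasDerivAt (fun x => 2 * a * iteratedDeriv 2 y₁ x + iteratedDeriv 2 y₂ x)
      (2 * a * iteratedDeriv 3 y₁ x + iteratedDeriv 3 y₂ x) x := fun x =>
    ((h12 x).const_mul (2 * a)).add (h22 x)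
  have hode : ∀ x, (2 * a * iteratedDeriv 3 y₁ x + iteratedDeriv 3 y₂ x) -
      x ^ 2 * (2 * a * iteratedDeriv 2 y₁ x + iteratedDeriv 2 y₂ x) -
      x * (2 * a * deriv y₁ x + deriv y₂ x - 2 * a ^ 2) + u x = 0 := fun x => by
    rw [hu]
    linear_combination 2 * a * hy₁ode x + hy₂ode x
  refine ⟨fun x => ?_, ?_⟩
  · have e1 : deriv u = fun x => 2 * a * deriv y₁ x + deriv y₂ x - 2 * a ^ 2 :=
      funext fun x => (hu0 x).deriv
    have e2 : iteratedDeriv 2 u =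
        fun x => 2 * a * iteratedDeriv 2 y₁ x + iteratedDeriv 2 y₂ x := by
      rw [iteratedDeriv_succ, iteratedDeriv_one, e1]
      exact funext fun x => (hu1 x).deriv
    have e3 : iteratedDeriv 3 u x = 2 * a * iteratedDeriv 3 y₁ x + iteratedDeriv 3 y₂ x := by
      rw [iteratedDeriv_succ, e2]
      exact (hu2 x).deriv
    rw [e3, e2, e1]
    exact hode x
  · obtain ⟨C, hC0, hC⟩ := exists_abs_tsum_sub_le hcsum
    obtain ⟨D, hD0, hD⟩ := exists_abs_tsum_sub_le hdsum
    have hbound : ∀ x : ℝ, |x| ≤ 1 →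
        |u x - (2 * a - 2 * a ^ 2 * x + x ^ 2)| ≤ (|2 * a| * C + D) * |x| ^ 3 := fun x hx => by
      have hc := hC x hx
      have hd := hD x hx
      rw [← hy₁, hc0] at hc
      rw [hd0] at hd
      have hx2 : |x ^ 2| ≤ 1 := by
        rw [abs_pow]; exact pow_le_one₀ (abs_nonneg x) hx
      have e : u x - (2 * a - 2 * a ^ 2 * x + x ^ 2) =
          2 * a * (y₁ x - 1) + x ^ 2 * (∑' r : ℕ, d r * x ^ (3 * r) - 1) := by
        rw [hu, hy₂]; ring
      calc _ ≤ |2 * a| * |y₁ x - 1| + |x ^ 2| * |∑' r : ℕ, d r * x ^ (3 * r) - 1| := by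
            rw [e, ← abs_mul, ← abs_mul]; exact abs_add_le _ _
        _ ≤ |2 * a| * (C * |x| ^ 3) + 1 * (D * |x| ^ 3) := by gcongr
        _ = _ := by ring
    have hp0 : ∀ x, HasDerivAt (fun x => u x - (2 * a - 2 * a ^ 2 * x + x ^ 2))
        (2 * a * deriv y₁ x + deriv y₂ x - 2 * a ^ 2 - (-(2 * a ^ 2) + 2 * x)) x := fun x => by
      simpa using (hu0 x).fun_sub ((((hasDerivAt_id x).const_mul (2 * a ^ 2)).const_sub
        (2 * a)).fun_add (hasDerivAt_pow 2 x))
    have hp1 : HasDerivAt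
        (fun x => 2 * a * deriv y₁ x + deriv y₂ x - 2 * a ^ 2 - (-(2 * a ^ 2) + 2 * x))
        (2 * a * iteratedDeriv 2 y₁ 0 + iteratedDeriv 2 y₂ 0 - 2) 0 := by
      simpa using (hu1 0).fun_sub (((hasDerivAt_id (0 : ℝ)).const_mul 2).const_add (-(2 * a ^ 2)))
    obtain ⟨i0, i1, i2⟩ := eq_zero_of_abs_le_cube hp0 hp1 hbound
    refine tendsto_mul_of_ode hu0 hu1 hu2 hode ?_ ?_ ?_
    · linarith
    · linarith
    · linarith
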